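/- For every nonnegative integer $n$, the finite summation identity $\sum_{k=0}^{n}(3+4k)\frac{((1)_k)^3(-n)_k}{((3/2)_k)^3(5/2+n)_k}\Big\{4H_{1+2k}^{(2)}-2H_k^{(2)}-4\Big\} = \frac{3+2n}{1+2n}\sum_{k=0}^{n}\frac{(1/2)_k(1)_k(-n)_k}{((3/2)_k)^2(1/2-n)_k}\Big\{4H_{1+2k}^{(2)}-H_k^{(2)}-4\Big\}$ holds. -/

import Mathlib

open scoped BigOperators

/-- The shifted factorial (Pochhammer symbol) `(x)_n = x (x+1) ⋯ (x+n-1)`. -/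
noncomputable def poch (x : ℝ) (n : ℕ) : ℝ := ∏ i ∈ Finset.range n, (x + i)

/-- The harmonic numbers of order 2, `H_n^{(2)} = ∑_{j=1}^n 1/j²`. -/
noncomputable def H2 (n : ℕ) : ℝ := ∑ j ∈ Finset.range n, 1 / ((j : ℝ) + 1) ^ 2

/-- The Dirichlet beta value `β(4) = ∑_{k≥0} (-1)^k/(1+2k)⁴`. -/
noncomputable def beta4 : ℝ := ∑' k : ℕ, (-1) ^ k / (1 + 2 * (k : ℝ)) ^ 4

/-- The Catalan constant `G = ∑_{k≥0} (-1)^k/(1+2k)²`. -/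
noncomputable def catalanG : ℝ := ∑' k : ℕ, (-1) ^ k / (1 + 2 * (k : ℝ)) ^ 2

theorem poch_zero (x : ℝ) : poch x 0 = 1 := by simp [poch]

theorem poch_succ (x : ℝ) (k : ℕ) : poch x (k + 1) = poch x k * (x + k) := by
  simp [poch, Finset.prod_range_succ]

theorem poch_shift (x : ℝ) (k : ℕ) : poch (x + 1) k * x = poch x k * (x + k) := by
  rw [← poch_succ, poch, poch, Finset.prod_range_succ']
  push_cast
  simp only [add_zero]
  congr 1
  exact Finset.prod_congr rfl fun i _ => by ring

theorem poch_pos {x : ℝ} (hx : 0 < x) (k : ℕ) : 0 < poch x k :=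
  Finset.prod_pos fun i _ => by positivity

theorem poch_neg_eq_zero {m k : ℕ} (h : m < k) : poch (-(m : ℝ)) k = 0 :=
  Finset.prod_eq_zero (Finset.mem_range.2 h) (by simp)

theorem half_sub_add_ne_zero (n i : ℕ) : (1 / 2 - n + i : ℝ) ≠ 0 := by
  intro h
  have h' : (1 + 2 * i : ℝ) = 2 * n := by linarith
  have : 1 + 2 * i = 2 * n := by exact_mod_cast h'
  omega

theorem poch_half_sub_ne_zero (n k : ℕ) : poch (1 / 2 - n) k ≠ 0 :=
  Finset.prod_ne_zero_iff.2 fun i _ => half_sub_add_ne_zero n i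

/-- The sum `∑_{j < k} 1 / (j + 3/2)²`. -/
noncomputable def oddH2 (k : ℕ) : ℝ := ∑ j ∈ Finset.range k, 1 / ((j : ℝ) + 3 / 2) ^ 2

theorem oddH2_succ (k : ℕ) : oddH2 (k + 1) = oddH2 k + 1 / ((k : ℝ) + 3 / 2) ^ 2 := by
  simp [oddH2, Finset.sum_range_succ]

theorem H2_succ (k : ℕ) : H2 (k + 1) = H2 k + 1 / ((k : ℝ) + 1) ^ 2 := by
  simp [H2, Finset.sum_range_succ]

theorem four_mul_H2_odd (k : ℕ) : 4 * H2 (1 + 2 * k) = oddH2 k + H2 k + 4 := by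
  induction k with
  | zero => simp [H2, oddH2]
  | succ k ih =>
    rw [show 1 + 2 * (k + 1) = 1 + 2 * k + 1 + 1 by ring, H2_succ, H2_succ, H2_succ, oddH2_succ,
      mul_add, mul_add, ih]
    push_cast
    have h1 : (k : ℝ) + 1 ≠ 0 := by positivity
    have h2 : (k : ℝ) + 3 / 2 ≠ 0 := by positivity
    have h3 : (1 + 2 * k + 1 : ℝ) ≠ 0 := by positivity
    have h4 : (1 + 2 * k + 1 + 1 : ℝ) ≠ 0 := by positivity
    field_simp
    ring

/-- The coefficient `(1/2)_j / (j! (3/2)_j²)`. -/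
noncomputable def saalCoeff (j : ℕ) : ℝ := poch (1 / 2) j / (poch 1 j * poch (3 / 2) j ^ 2)

theorem saalCoeff_succ (j : ℕ) :
    saalCoeff (j + 1) * ((j + 1) * ((j : ℝ) + 3 / 2) ^ 2) = saalCoeff j * (j + 1 / 2) := by
  have h1 := (poch_pos one_pos j).ne'
  have h2 := (poch_pos (x := 3 / 2) (by norm_num) j).ne'
  have h3 : (1 + j : ℝ) ≠ 0 := by positivity
  have h4 : (3 / 2 + j : ℝ) ≠ 0 := by positivity
  simp only [saalCoeff, poch_succ]
  field_simp
  ring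

/-- The terminating Saalschützian summand. -/
noncomputable def saalTerm (k j : ℕ) : ℝ :=
  poch (-(k : ℝ)) j * poch (3 / 2 + k) j * saalCoeff j

/-- The common factor of the telescoping certificates for `saalTerm`. -/
noncomputable def saalCert (k j : ℕ) : ℝ :=
  -(4 * k + 5) / (2 * k + 3) * (j / (k + 1)) *
    (poch (-((k + 1 : ℕ) : ℝ)) j * poch (3 / 2 + k) j * saalCoeff j)

theorem saalCert_zero (k : ℕ) : saalCert k 0 = 0 := by simp [saalCert]

theorem saalCert_eq_zero {k j : ℕ} (h : k + 1 < j) : saalCert k j = 0 := by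
  rw [saalCert, poch_neg_eq_zero h, zero_mul, zero_mul, mul_zero]

/-- A common factor in terms of which all neighbouring summands are polynomial. -/
theorem saal_neighbours (k j : ℕ) : ∃ g : ℝ,
    saalTerm k j = g * (k + 1 - j) ∧
    saalTerm (k + 1) j = g * ((k + 1) * (3 / 2 + k + j) / (3 / 2 + k)) ∧
    saalCert k j = -(4 * k + 5) / (2 * k + 3) * j * g ∧
    saalCert k (j + 1) * ((j : ℝ) + 3 / 2) ^ 2 =
      (4 * k + 5) / (2 * k + 3) * (k + 1 - j) * (3 / 2 + k + j) * (j + 1 / 2) * g := by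
  have hk : (k + 1 : ℝ) ≠ 0 := by positivity
  have a1 := poch_shift (-((k + 1 : ℕ) : ℝ)) j
  have a2 := poch_shift (3 / 2 + k) j
  have a3 := saalCoeff_succ j
  rw [show -((k + 1 : ℕ) : ℝ) + 1 = -(k : ℝ) by push_cast; ring] at a1
  rw [show (3 / 2 + k + 1 : ℝ) = 3 / 2 + ((k + 1 : ℕ) : ℝ) by push_cast; ring] at a2
  refine ⟨poch (-((k + 1 : ℕ) : ℝ)) j * poch (3 / 2 + k) j * saalCoeff j / (k + 1),
    ?_, ?_, ?_, ?_⟩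
  · rw [saalTerm, div_mul_eq_mul_div, eq_div_iff hk]
    push_cast at a1 ⊢
    linear_combination -poch (3 / 2 + k) j * saalCoeff j * a1
  · rw [saalTerm, div_mul_div_comm, eq_div_iff (by positivity)]
    linear_combination poch (-((k + 1 : ℕ) : ℝ)) j * saalCoeff j * (k + 1) * a2
  · rw [saalCert]
    ring
  · rw [saalCert, poch_succ, poch_succ]
    push_cast
    linear_combination (4 * k + 5) / (2 * k + 3) / (k + 1) * (k + 1 - j) * (3 / 2 + k + j) *
      poch (-(k + 1 : ℝ)) j * poch (3 / 2 + k) j * a3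

theorem saalTerm_telescope (k j : ℕ) :
    ((k : ℝ) + 3 / 2) ^ 2 * saalTerm (k + 1) j - ((k : ℝ) + 1) ^ 2 * saalTerm k j =
      saalCert k (j + 1) * (((j + 1 : ℕ) : ℝ) + 1 / 2) ^ 2
        - saalCert k j * ((j : ℝ) + 1 / 2) ^ 2 := by
  obtain ⟨g, h1, h2, h3, h4⟩ := saal_neighbours k j
  have e : (((j + 1 : ℕ) : ℝ) + 1 / 2) = j + 3 / 2 := by push_cast; ring
  rw [e, h4, h1, h2, h3]
  have hk2 : (3 / 2 + k : ℝ) ≠ 0 := by positivity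
  have hk3 : (2 * k + 3 : ℝ) ≠ 0 := by positivity
  field_simp
  ring

theorem saalTerm_mul_oddH2_telescope (k j : ℕ) :
    ((k : ℝ) + 3 / 2) ^ 2 * (saalTerm (k + 1) j * oddH2 j) - saalTerm (k + 1) j
      - (((k : ℝ) + 1) ^ 2 * (saalTerm k j * oddH2 j) - saalTerm k j) =
      saalCert k (j + 1) * ((((j + 1 : ℕ) : ℝ) + 1 / 2) ^ 2 * oddH2 (j + 1) - 1)
        - saalCert k j * (((j : ℝ) + 1 / 2) ^ 2 * oddH2 j - 1) := by
  have t := saalTerm_telescope k j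
  obtain ⟨g, h1, h2, h3, h4⟩ := saal_neighbours k j
  have e : (((j + 1 : ℕ) : ℝ) + 1 / 2) = j + 3 / 2 := by push_cast; ring
  have hj : (j + 3 / 2 : ℝ) ≠ 0 := by positivity
  have e2 : ((j : ℝ) + 3 / 2) ^ 2 * oddH2 (j + 1) - 1 = ((j : ℝ) + 3 / 2) ^ 2 * oddH2 j := by
    rw [oddH2_succ]
    field_simp
    ring
  have e3 : saalTerm k j - saalTerm (k + 1) j = saalCert k j := by
    rw [h1, h2, h3]
    have hk2 : (3 / 2 + k : ℝ) ≠ 0 := by positivity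
    have hk3 : (2 * k + 3 : ℝ) ≠ 0 := by positivity
    field_simp
    ring
  rw [e] at t ⊢
  rw [e2]
  linear_combination oddH2 j * t + e3

/-- The Saalschütz evaluation together with its derivative in the parameter. -/
theorem sum_saalTerm {N k : ℕ} (h : k < N) :
    ∑ j ∈ Finset.range N, saalTerm k j = poch 1 k ^ 2 / poch (3 / 2) k ^ 2 ∧
    ∑ j ∈ Finset.range N, saalTerm k j * oddH2 j =
      poch 1 k ^ 2 / poch (3 / 2) k ^ 2 * (oddH2 k - H2 k) := by
  induction k with
  | zero =>
    obtain ⟨M, rfl⟩ : ∃ M, N = M + 1 := ⟨N - 1, by omega⟩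
    have hz (j : ℕ) : saalTerm 0 (j + 1) = 0 := by
      rw [saalTerm, poch_neg_eq_zero j.succ_pos, zero_mul, zero_mul]
    simp only [Finset.sum_range_succ', hz]
    simp [saalTerm, saalCoeff, poch_zero, oddH2, H2]
  | succ k ih =>
    obtain ⟨ihS, ihT⟩ := ih (by omega)
    have s := Finset.sum_congr (rfl : Finset.range N = _) fun j _ => saalTerm_telescope k j
    have t := Finset.sum_congr (rfl : Finset.range N = _)
      fun j _ => saalTerm_mul_oddH2_telescope k j
    rw [Finset.sum_range_sub (fun j : ℕ => saalCert k j * ((j : ℝ) + 1 / 2) ^ 2)] at s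
    rw [Finset.sum_range_sub
      (fun j : ℕ => saalCert k j * (((j : ℝ) + 1 / 2) ^ 2 * oddH2 j - 1))] at t
    simp only [saalCert_zero, saalCert_eq_zero h, Finset.sum_sub_distrib, ← Finset.mul_sum,
      zero_mul, sub_zero] at s t
    rw [ihS] at s t
    rw [ihT] at t
    have h1 := (poch_pos (x := 3 / 2) (by norm_num) k).ne'
    have h2 : (k + 3 / 2 : ℝ) ≠ 0 := by positivity
    have h3 : (k + 1 : ℝ) ≠ 0 := by positivity
    have hS : ∑ j ∈ Finset.range N, saalTerm (k + 1) j =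
        poch 1 k ^ 2 / poch (3 / 2) k ^ 2 * ((k + 1) ^ 2 / ((k : ℝ) + 3 / 2) ^ 2) := by
      rw [← mul_div_assoc, eq_div_iff (by positivity)]
      linear_combination s
    have hP : poch 1 (k + 1) ^ 2 / poch (3 / 2) (k + 1) ^ 2 =
        poch 1 k ^ 2 / poch (3 / 2) k ^ 2 * ((k + 1) ^ 2 / ((k : ℝ) + 3 / 2) ^ 2) := by
      rw [poch_succ, poch_succ, add_comm (1 : ℝ), add_comm (3 / 2 : ℝ), mul_pow, mul_pow,
        div_mul_div_comm]
    refine ⟨hS.trans hP.symm, ?_⟩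
    rw [hP, oddH2_succ, H2_succ]
    rw [hS] at t
    apply mul_left_cancel₀ (pow_ne_zero 2 h2)
    rw [show ((k : ℝ) + 3 / 2) ^ 2 * ∑ j ∈ Finset.range N, saalTerm (k + 1) j * oddH2 j = _ from
      eq_add_of_sub_eq (eq_add_of_sub_eq t)]
    generalize poch 1 k ^ 2 / poch (3 / 2) k ^ 2 = P
    field_simp
    ring

/-- The well-poised weight without its linear factor. -/
noncomputable def wpWeight (n k : ℕ) : ℝ :=
  poch 1 k * poch (-(n : ℝ)) k / (poch (3 / 2) k * poch (5 / 2 + n) k)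

theorem wpWeight_succ (n k : ℕ) :
    wpWeight n (k + 1) * ((k + 3 / 2) * (k + n + 5 / 2)) =
      wpWeight n k * ((k + 1) * (k - n)) := by
  have h1 := (poch_pos (x := 3 / 2) (by norm_num) k).ne'
  have h2 := (poch_pos (x := 5 / 2 + n) (by positivity) k).ne'
  simp only [wpWeight, poch_succ]
  rw [div_mul_eq_mul_div, div_mul_eq_mul_div, div_eq_div_iff (by positivity) (by positivity)]
  ring

theorem wpWeight_eq_zero (n : ℕ) : wpWeight n (n + 1) = 0 := by
  simp [wpWeight, poch_neg_eq_zero n.lt_succ_self]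

theorem sum_wpWeight (n : ℕ) :
    ∑ k ∈ Finset.range (n + 1), (3 + 4 * (k : ℝ)) * wpWeight n k =
      (3 + 2 * (n : ℝ)) / (1 + 2 * (n : ℝ)) := by
  have hn : (1 + 2 * n : ℝ) ≠ 0 := by positivity
  have key (k : ℕ) : (3 + 4 * (k : ℝ)) * wpWeight n k =
      -4 / (1 + 2 * (n : ℝ)) * ((((k + 1 : ℕ) : ℝ) + 1 / 2) * ((k + 1 : ℕ) + n + 3 / 2)
          * wpWeight n (k + 1))
        - -4 / (1 + 2 * (n : ℝ)) * (((k : ℝ) + 1 / 2) * (k + n + 3 / 2) * wpWeight n k) := by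
    have := wpWeight_succ n k
    push_cast
    field_simp
    linear_combination 16 * this
  rw [Finset.sum_congr rfl fun k _ => key k, Finset.sum_range_sub
    (fun k : ℕ => -4 / (1 + 2 * (n : ℝ)) * (((k : ℝ) + 1 / 2) * (k + n + 3 / 2) * wpWeight n k)),
    wpWeight_eq_zero]
  simp [wpWeight, poch_zero]
  field_simp
  ring

theorem sum_wpWeight_mul_poch (n j : ℕ) :
    ∑ k ∈ Finset.range (n + 1), (3 + 4 * (k : ℝ)) * wpWeight n k *
        (poch (-(k : ℝ)) j * poch (3 / 2 + k) j) =
      (3 + 2 * (n : ℝ)) / (1 + 2 * (n : ℝ)) *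
        (poch 1 j ^ 2 * poch (-(n : ℝ)) j / poch (1 / 2 - n) j) := by
  induction j with
  | zero => simpa [poch_zero] using sum_wpWeight n
  | succ j ih =>
    have key (k : ℕ) :
        (1 / 2 - n + j) * ((3 + 4 * (k : ℝ)) * wpWeight n k *
          (poch (-(k : ℝ)) (j + 1) * poch (3 / 2 + k) (j + 1))) -
        (1 + j) ^ 2 * (-n + j) * ((3 + 4 * (k : ℝ)) * wpWeight n k *
          (poch (-(k : ℝ)) j * poch (3 / 2 + k) j)) =
        -2 * (((k + 1 : ℕ) : ℝ) + 1 / 2) ^ 2 * ((k + 1 : ℕ) + n + 3 / 2) * ((k + 1 : ℕ) - j) *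
          (wpWeight n (k + 1) * (poch (-((k + 1 : ℕ) : ℝ)) j * poch (3 / 2 + (k + 1 : ℕ)) j)) -
        -2 * ((k : ℝ) + 1 / 2) ^ 2 * (k + n + 3 / 2) * (k - j) *
          (wpWeight n k * (poch (-(k : ℝ)) j * poch (3 / 2 + k) j)) := by
      have a0 := wpWeight_succ n k
      have a1 := poch_shift (-((k + 1 : ℕ) : ℝ)) j
      have a2 := poch_shift (3 / 2 + k) j
      rw [show -((k + 1 : ℕ) : ℝ) + 1 = -(k : ℝ) by push_cast; ring] at a1
      rw [show (3 / 2 + k + 1 : ℝ) = 3 / 2 + ((k + 1 : ℕ) : ℝ) by push_cast; ring] at a2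
      rw [poch_succ, poch_succ]
      generalize poch (-((k + 1 : ℕ) : ℝ)) j = p1 at *
      generalize poch (3 / 2 + ((k + 1 : ℕ) : ℝ)) j = q1 at *
      generalize poch (-(k : ℝ)) j = p at *
      generalize poch (3 / 2 + (k : ℝ)) j = q at *
      generalize wpWeight n k = w at *
      generalize wpWeight n (k + 1) = w1 at *
      push_cast at *
      have b1 : p1 * (k + 1 - j) = p * (k + 1) := by linear_combination a1
      have hprod : (k + 3 / 2) ^ 2 * (k + n + 5 / 2) * (k + 1 - j) * (w1 * (p1 * q1)) =
          (k + 1) ^ 2 * (k - n) * (k + 3 / 2 + j) * (w * (p * q)) := by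
        calc _ = (w1 * ((k + 3 / 2) * (k + n + 5 / 2))) * (p1 * (k + 1 - j)) *
              (q1 * (3 / 2 + k)) := by ring
          _ = _ := by rw [a0, b1, a2]; ring
      linear_combination 2 * hprod
    have s := Finset.sum_congr (rfl : Finset.range (n + 1) = _) fun k _ => key k
    rw [Finset.sum_range_sub
      (fun k : ℕ => -2 * ((k : ℝ) + 1 / 2) ^ 2 * (k + n + 3 / 2) * (k - j) *
          (wpWeight n k * (poch (-(k : ℝ)) j * poch (3 / 2 + k) j)))] at s
    have hz : ((0 : ℕ) - j : ℝ) * poch (-((0 : ℕ) : ℝ)) j = 0 := by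
      rcases Nat.eq_zero_or_pos j with rfl | hj
      · simp
      · rw [poch_neg_eq_zero hj, mul_zero]
    rw [Finset.sum_sub_distrib, ← Finset.mul_sum, ← Finset.mul_sum, wpWeight_eq_zero, ih] at s
    have hne := half_sub_add_ne_zero n j
    have hp := poch_half_sub_ne_zero n j
    apply mul_left_cancel₀ hne
    rw [poch_succ 1, poch_succ (-(n : ℝ)), poch_succ (1 / 2 - (n : ℝ))]
    have e : (1 / 2 - n + j : ℝ) * ((3 + 2 * (n : ℝ)) / (1 + 2 * (n : ℝ)) *
        ((poch 1 j * (1 + j)) ^ 2 * (poch (-(n : ℝ)) j * (-n + j)) /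
          (poch (1 / 2 - n) j * (1 / 2 - n + j)))) =
        (1 + j) ^ 2 * (-n + j) * ((3 + 2 * (n : ℝ)) / (1 + 2 * (n : ℝ)) *
          (poch 1 j ^ 2 * poch (-(n : ℝ)) j / poch (1 / 2 - n) j)) := by
      generalize (1 / 2 - n + j : ℝ) = c at *
      generalize poch (1 / 2 - n) j = d at *
      field_simp
    rw [e]
    linear_combination s + 2 * (((0 : ℕ) : ℝ) + 1 / 2) ^ 2 * ((0 : ℕ) + n + 3 / 2) *
      wpWeight n 0 * poch (3 / 2 + (0 : ℕ)) j * hz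

theorem stmt10 (n : ℕ) :
    (∑ k ∈ Finset.range (n + 1), (3 + 4 * (k : ℝ)) *
        (poch 1 k ^ 3 * poch (-(n : ℝ)) k / (poch (3/2) k ^ 3 * poch (5/2 + n) k)) *
        (4 * H2 (1 + 2 * k) - 2 * H2 k - 4)) =
      (3 + 2 * (n : ℝ)) / (1 + 2 * (n : ℝ)) *
        ∑ k ∈ Finset.range (n + 1),
          poch (1/2) k * poch 1 k * poch (-(n : ℝ)) k /
            (poch (3/2) k ^ 2 * poch (1/2 - n) k) *
          (4 * H2 (1 + 2 * k) - H2 k - 4) := by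
  have hl (k : ℕ) (hk : k ∈ Finset.range (n + 1)) : (3 + 4 * (k : ℝ)) *
        (poch 1 k ^ 3 * poch (-(n : ℝ)) k / (poch (3/2) k ^ 3 * poch (5/2 + n) k)) *
        (4 * H2 (1 + 2 * k) - 2 * H2 k - 4) =
      ∑ j ∈ Finset.range (n + 1), (3 + 4 * (k : ℝ)) * wpWeight n k *
        (poch (-(k : ℝ)) j * poch (3 / 2 + k) j) * (saalCoeff j * oddH2 j) := by
    have h := (sum_saalTerm (Finset.mem_range.1 hk)).2
    calc _ = (3 + 4 * (k : ℝ)) * wpWeight n k *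
          (poch 1 k ^ 2 / poch (3 / 2) k ^ 2 * (oddH2 k - H2 k)) := by
          rw [four_mul_H2_odd, wpWeight]
          ring
      _ = _ := by
          rw [← h, Finset.mul_sum]
          exact Finset.sum_congr rfl fun j _ => by rw [saalTerm]; ring
  rw [Finset.sum_congr rfl hl, Finset.sum_comm, Finset.mul_sum]
  refine Finset.sum_congr rfl fun j _ => ?_
  rw [← Finset.sum_mul, sum_wpWeight_mul_poch, four_mul_H2_odd, saalCoeff]
  have h1 := (poch_pos one_pos j).ne'
  have h2 := (poch_pos (x := 3 / 2) (by norm_num) j).ne'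
  have h3 := poch_half_sub_ne_zero n j
  generalize poch (1 / 2 - n) j = d at *
  field_simp
  ring
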